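/- arXiv:1805.01331 — 2 statements merged into one kernel-verified Lean document; each statement's English description precedes it below -/
import Mathlib

section
/- Let Ω ⊂ ℝ be a compact interval and let c : Ω^l → ℝ be a C² convex function with ∂²c/∂x_i∂x_j ≤ 0 for all i ≠ j. Then the multi-marginal transport functional W_c(ρ_1,…,ρ_l) := inf { ∫_{Ω^l} c dγ : γ ∈ Π(ρ_1,…,ρ_l) } is geodesically convex on (P^{ac}(Ω))^l: for any two l-tuples (ρ_1^0,…,ρ_l^0), (ρ_1^1,…,ρ_l^1) of absolutely continuous probability measures and for ρ_i^t the constant-speed W_2-geodesic (McCann interpolation) between ρ_i^0 and ρ_i^1, one has W_c(ρ_1^t,…,ρ_l^t) ≤ (1−t) W_c(ρ_1^0,…,ρ_l^0) + t W_c(ρ_1^1,…,ρ_l^1) for all t ∈ [0,1]. -/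
open MeasureTheory Set

noncomputable section

/-- Quadratic Wasserstein distance. -/
noncomputable def W2 {E : Type*} [MeasurableSpace E] [NormedAddCommGroup E]
    (μ ν : Measure E) : ℝ :=
  Real.sqrt (sInf { r : ℝ | ∃ π : Measure (E × E), IsProbabilityMeasure π ∧
    π.map Prod.fst = μ ∧ π.map Prod.snd = ν ∧ r = ∫ p, ‖p.1 - p.2‖ ^ 2 ∂π })

/-- Multi-marginal transport plans with prescribed marginals. -/
def Plans {E : Type*} [MeasurableSpace E] {l : ℕ} (ρ : Fin l → Measure E) :
    Set (Measure (Fin l → E)) :=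
  { γ | IsProbabilityMeasure γ ∧ ∀ i, γ.map (fun x => x i) = ρ i }

/-- Value of the multi-marginal optimal transport problem with cost `c`. -/
noncomputable def Wc {E : Type*} [MeasurableSpace E] {l : ℕ}
    (c : (Fin l → E) → ℝ) (ρ : Fin l → Measure E) : ℝ :=
  sInf ((fun γ => ∫ x, c x ∂γ) '' Plans ρ)

open ProbabilityTheory Filter Topology

/-- Discrete dual potentials for a submodular function along a monotone sequence. -/
lemma discrete_potential {l : ℕ} (c : (Fin l → ℝ) → ℝ)
    (hsub : ∀ x y, c (x ⊔ y) + c (x ⊓ y) ≤ c x + c y)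
    (p : ℕ → Fin l → ℝ) (hp : Monotone p) :
    ∃ φ : Fin l → ℕ → ℝ, (∀ k, ∑ i, φ i k = c (p k) - c (p 0)) ∧
      ∀ κ : Fin l → ℕ, ∑ i, φ i (κ i) ≤ c (fun i => p (κ i) i) - c (p 0) := by
  let upd : ℕ → ℕ → Fin l → ℝ := fun m j i => if (i : ℕ) < j then p (m+1) i else p m i
  let δ : ℕ → ℕ → ℝ := fun j m => c (upd m (j+1)) - c (upd m j)
  have upd0 : ∀ m, upd m 0 = p m := by intro m; ext i; simp [upd]
  have updl : ∀ m, upd m l = p (m+1) := by intro m; ext i; simp [upd]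
  refine ⟨fun i k => ∑ m ∈ Finset.range k, δ i m, ?_, ?_⟩
  · intro k
    rw [Finset.sum_comm]
    have : ∀ m, ∑ i : Fin l, δ i m = c (p (m+1)) - c (p m) := by
      intro m
      rw [Fin.sum_univ_eq_sum_range (fun j => δ j m) l]
      simp only [δ]
      rw [Finset.sum_range_sub (fun j => c (upd m j)), upd0, updl]
    simp_rw [this]
    rw [Finset.sum_range_sub (fun m => c (p m))]
  · intro κ
    have key : ∀ M, ∑ i : Fin l, ∑ m ∈ Finset.range (min (κ i) M), δ i m
        ≤ c (fun i => p (min (κ i) M) i) - c (p 0) := by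
      intro M
      induction M with
      | zero => simp
      | succ M ih =>
        let z : ℕ → Fin l → ℝ := fun j i =>
          if (i : ℕ) < j then p (min (κ i) (M+1)) i else p (min (κ i) M) i
        have z0 : z 0 = fun i => p (min (κ i) M) i := by ext i; simp [z]
        have zl : z l = fun i => p (min (κ i) (M+1)) i := by ext i; simp [z]
        have step : ∀ j : Fin l, (∑ m ∈ Finset.range (min (κ j) (M+1)), δ j m)
            - (∑ m ∈ Finset.range (min (κ j) M), δ j m) ≤ c (z (j+1)) - c (z j) := by
          intro j
          by_cases hj : M < κ j
          · have e1 : min (κ j) (M+1) = M + 1 := by omega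
            have e2 : min (κ j) M = M := by omega
            rw [e1, e2, Finset.sum_range_succ]
            have hs := hsub (z (j+1)) (upd M j)
            have hsup : z (j+1) ⊔ upd M j = upd M (j+1) := by
              ext i
              simp only [Pi.sup_apply, z, upd]
              rcases lt_trichotomy (i : ℕ) j with h | h | h
              · rw [if_pos (by omega), if_pos h, if_pos (by omega)]
                exact sup_eq_right.2 (hp (by omega) i)
              · have : i = j := Fin.ext h
                subst this
                rw [if_pos (by omega), if_neg (by omega), if_pos (by omega), e1]
                exact sup_eq_left.2 (hp (by omega) i)
              · rw [if_neg (by omega), if_neg (by omega), if_neg (by omega)]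
                exact sup_eq_right.2 (hp (by omega) i)
            have hinf : z (j+1) ⊓ upd M j = z j := by
              ext i
              simp only [Pi.inf_apply, z, upd]
              rcases lt_trichotomy (i : ℕ) j with h | h | h
              · rw [if_pos (by omega), if_pos h, if_pos (by omega)]
                exact inf_eq_left.2 (hp (by omega) i)
              · have : i = j := Fin.ext h
                subst this
                rw [if_pos (by omega), if_neg (by omega), if_neg (by omega), e1, e2]
                exact inf_eq_right.2 (hp (by omega) i)
              · rw [if_neg (by omega), if_neg (by omega), if_neg (by omega)]
                exact inf_eq_left.2 (hp (by omega) i)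
            rw [hsup, hinf] at hs
            simp only [δ]
            linarith
          · have e1 : min (κ j) (M+1) = min (κ j) M := by omega
            have : z (j+1) = z j := by
              ext i
              simp only [z]
              rcases lt_trichotomy (i : ℕ) j with h | h | h
              · rw [if_pos (by omega), if_pos h]
              · have : i = j := Fin.ext h
                subst this
                rw [if_pos (by omega), if_neg (by omega), e1]
              · rw [if_neg (by omega), if_neg (by omega)]
            rw [e1, this]; simp
        have hsum := Finset.sum_le_sum (fun j (_ : j ∈ Finset.univ) => step j)
        rw [Fin.sum_univ_eq_sum_range (fun j => c (z (j+1)) - c (z j)) l,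
          Finset.sum_range_sub (fun j => c (z j)), z0, zl, Finset.sum_sub_distrib] at hsum
        linarith
    have h := key (Finset.univ.sup κ)
    have : ∀ i, min (κ i) (Finset.univ.sup κ) = κ i := fun i =>
      min_eq_left (Finset.le_sup (Finset.mem_univ i))
    simpa only [this] using h

/-- The uniform law on the unit interval. -/
abbrev lam : Measure ℝ := volume.restrict (Ioc (0:ℝ) 1)

instance lam_prob : IsProbabilityMeasure lam := ⟨by simp [lam]⟩

lemma cont_bdd_integrable {X : Type*} [MeasurableSpace X] (γ : Measure X)
    [IsProbabilityMeasure γ] (g : X → ℝ) (hg : Measurable g) (M : ℝ) (hM : ∀ x, |g x| ≤ M) :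
    Integrable g γ :=
  Integrable.of_bound hg.aestronglyMeasurable M (Eventually.of_forall hM)

lemma comonotone_le {l : ℕ} (c : (Fin l → ℝ) → ℝ)
    (hsub : ∀ x y, c (x ⊔ y) + c (x ⊓ y) ≤ c x + c y)
    (hcont : Continuous c) (B : ℝ) (hB : ∀ x, |c x| ≤ B)
    (f : Fin l → ℝ → ℝ) (hf : ∀ i, Monotone (f i))
    {X : Type*} [MeasurableSpace X] (γ : Measure X) [IsProbabilityMeasure γ]
    (U : Fin l → X → ℝ) (hU : ∀ i, Measurable (U i)) (hlaw : ∀ i, γ.map (U i) = lam) :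
    ∫ u, c (fun i => f i u) ∂lam ≤ ∫ x, c (fun i => f i (U i x)) ∂γ := by
  let k : ℕ → ℝ → ℕ := fun n u => min ⌊u * n⌋₊ n
  have kmeas : ∀ n, Measurable (k n) := by
    intro n
    exact (Nat.measurable_floor.comp (measurable_id.mul_const _)).min measurable_const
  let g : ℕ → Fin l → ℝ → ℝ := fun n i u => f i ((k n u : ℝ) / n)
  have gmeas : ∀ n i, Measurable (g n i) := by
    intro n i
    exact (hf i).measurable.comp
      (((measurable_from_top (f := fun m : ℕ => (m:ℝ))).comp (kmeas n)).div_const _)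
  have klim : ∀ u ∈ Ioc (0:ℝ) 1, Tendsto (fun n : ℕ => (k n u : ℝ) / n) atTop (𝓝 u) := by
    intro u hu
    have h := (tendsto_nat_floor_mul_div_atTop (R := ℝ) hu.1.le).comp
      (tendsto_natCast_atTop_atTop (R := ℝ))
    refine h.congr fun n => ?_
    have : ⌊u * n⌋₊ ≤ n := by
      apply Nat.floor_le_of_le
      nlinarith [hu.2, (Nat.cast_nonneg n : (0:ℝ) ≤ n)]
    simp [k, min_eq_left this]
  have glim : ∀ i, ∀ᵐ u ∂lam, Tendsto (fun n => g n i u) atTop (𝓝 (f i u)) := by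
    intro i
    have h1 : ∀ᵐ u ∂lam, u ∈ Ioc (0:ℝ) 1 := ae_restrict_mem measurableSet_Ioc
    have h2 : ∀ᵐ u ∂lam, ContinuousAt (f i) u := by
      have := (hf i).countable_not_continuousAt.measure_zero lam
      exact this
    filter_upwards [h1, h2] with u hu1 hu2
    exact hu2.tendsto.comp (klim u hu1)
  have step : ∀ n, ∫ u, c (fun i => g n i u) ∂lam ≤ ∫ x, c (fun i => g n i (U i x)) ∂γ := by
    intro n
    obtain ⟨φ, h1, h2⟩ := discrete_potential c hsub (fun m i => f i ((m:ℝ)/n)) (by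
      intro m m' h i
      apply hf i
      gcongr)
    have φm : ∀ i, Measurable (fun u => φ i (k n u)) := fun i =>
      (measurable_from_top (f := φ i)).comp (kmeas n)
    have φb : ∀ i u, |φ i (k n u)| ≤ ∑ m ∈ Finset.range (n+1), |φ i m| := by
      intro i u
      apply Finset.single_le_sum (f := fun m => |φ i m|) (fun m _ => abs_nonneg _)
      simp only [Finset.mem_range, k]; omega
    have e1 : ∫ u, c (fun i => g n i u) ∂lam
        = (∑ i, ∫ u, φ i (k n u) ∂lam) + c (fun i => f i (((0:ℕ):ℝ)/n)) := by
      rw [← integral_finsetSum]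
      · have : ∀ u, c (fun i => g n i u) = (∑ i, φ i (k n u)) + c (fun i => f i (((0:ℕ):ℝ)/n)) := by
          intro u
          rw [h1]; simp [g]
        simp_rw [this]
        rw [integral_add]
        · simp
        · exact integrable_finsetSum _ fun i _ => cont_bdd_integrable _ _ (φm i) _ (φb i)
        · exact integrable_const _
      · exact fun i _ => cont_bdd_integrable _ _ (φm i) _ (φb i)
    have e2 : ∀ i, ∫ u, φ i (k n u) ∂lam = ∫ x, φ i (k n (U i x)) ∂γ := by
      intro i
      rw [← hlaw i, integral_map (hU i).aemeasurable (φm i).aestronglyMeasurable]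
    have I2 : ∀ i, Integrable (fun x => φ i (k n (U i x))) γ := fun i =>
      cont_bdd_integrable _ _ ((φm i).comp (hU i)) _ (fun x => φb i _)
    rw [e1]
    simp_rw [e2]
    rw [← integral_finsetSum _ (fun i _ => I2 i)]
    have : (∫ x, ∑ i, φ i (k n (U i x)) ∂γ) + c (fun i => f i (((0:ℕ):ℝ)/n))
        = ∫ x, ((∑ i, φ i (k n (U i x))) + c (fun i => f i (((0:ℕ):ℝ)/n))) ∂γ := by
      rw [integral_add (integrable_finsetSum _ fun i _ => I2 i) (integrable_const _)]
      simp
    rw [this]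
    apply integral_mono
    · exact (integrable_finsetSum _ fun i _ => I2 i).add (integrable_const _)
    · apply cont_bdd_integrable _ _ _ B (fun x => hB _)
      exact hcont.measurable.comp (measurable_pi_lambda _ fun i => (gmeas n i).comp (hU i))
    · intro x
      have := h2 (fun i => k n (U i x))
      simp only [g]
      linarith
  refine le_of_tendsto_of_tendsto' (b := atTop)
    (f := fun n => ∫ u, c (fun i => g n i u) ∂lam)
    (g := fun n => ∫ x, c (fun i => g n i (U i x)) ∂γ) ?_ ?_ step
  · refine tendsto_integral_of_dominated_convergence (fun _ => B) ?_ (integrable_const _)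
      (fun n => Eventually.of_forall fun u => hB _) ?_
    · intro n
      exact (hcont.measurable.comp (measurable_pi_lambda _ fun i => gmeas n i)).aestronglyMeasurable
    · filter_upwards [ae_all_iff.2 glim] with u hu
      exact (hcont.tendsto _).comp (tendsto_pi_nhds.2 hu)
  · refine tendsto_integral_of_dominated_convergence (fun _ => B) ?_ (integrable_const _)
      (fun n => Eventually.of_forall fun u => hB _) ?_
    · intro n
      exact (hcont.measurable.comp
        (measurable_pi_lambda _ fun i => (gmeas n i).comp (hU i))).aestronglyMeasurable
    · have : ∀ i, ∀ᵐ x ∂γ, Tendsto (fun n => g n i (U i x)) atTop (𝓝 (f i (U i x))) := by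
        intro i
        have := glim i
        rw [← hlaw i] at this
        exact ae_of_ae_map (hU i).aemeasurable this
      filter_upwards [ae_all_iff.2 this] with u hu
      exact (hcont.tendsto _).comp (tendsto_pi_nhds.2 hu)

lemma lam_Iic (y : ℝ) (h0 : 0 ≤ y) (h1 : y ≤ 1) : lam (Iic y) = ENNReal.ofReal y := by
  rw [Measure.restrict_apply measurableSet_Iic]
  have : Iic y ∩ Ioc 0 1 = Ioc 0 y := by
    ext u; simp only [mem_inter_iff, mem_Iic, mem_Ioc]
    constructor
    · rintro ⟨a, b, c⟩; exact ⟨b, a⟩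
    · rintro ⟨a, b⟩; exact ⟨b, a, b.trans h1⟩
  rw [this]; simp

lemma cdf_comp_monotone (ρ : Measure ℝ) [IsProbabilityMeasure ρ] (hρ : ρ ≪ volume)
    (f : ℝ → ℝ) (hf : Monotone f) (hpush : lam.map f = ρ) (u : ℝ) (hu : u ∈ Ioc (0:ℝ) 1) :
    cdf ρ (f u) = u := by
  have hat : ρ {f u} = 0 := hρ (by simp)
  have hlow : ENNReal.ofReal u ≤ ρ (Iic (f u)) := by
    rw [← hpush, Measure.map_apply hf.measurable measurableSet_Iic, ← lam_Iic u hu.1.le hu.2]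
    exact measure_mono fun v hv => hf hv
  have hup : ρ (Iic (f u)) ≤ ENNReal.ofReal u := by
    have : Iic (f u) = Iio (f u) ∪ {f u} := by simp
    calc ρ (Iic (f u)) ≤ ρ (Iio (f u)) + ρ {f u} := by rw [this]; exact measure_union_le _ _
      _ = ρ (Iio (f u)) := by rw [hat, add_zero]
      _ ≤ ENNReal.ofReal u := by
        rw [← hpush, Measure.map_apply hf.measurable measurableSet_Iio, ← lam_Iic u hu.1.le hu.2]
        refine measure_mono fun v hv => ?_
        by_contra h
        exact absurd (hf (le_of_lt (not_le.1 h))) (not_le.2 hv)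
  rw [cdf_eq_real, Measure.real, le_antisymm hup hlow, ENNReal.toReal_ofReal hu.1.le]

lemma comonotone_opt {l : ℕ} (c : (Fin l → ℝ) → ℝ)
    (hsub : ∀ x y, c (x ⊔ y) + c (x ⊓ y) ≤ c x + c y)
    (hcont : Continuous c) (B : ℝ) (hB : ∀ x, |c x| ≤ B)
    (f : Fin l → ℝ → ℝ) (hf : ∀ i, Monotone (f i))
    (ρ : Fin l → Measure ℝ) (hprob : ∀ i, IsProbabilityMeasure (ρ i)) (hac : ∀ i, ρ i ≪ volume)
    (hpush : ∀ i, lam.map (f i) = ρ i) (γ : Measure (Fin l → ℝ)) (hγ : γ ∈ Plans ρ) :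
    ∫ u, c (fun i => f i u) ∂lam ≤ ∫ x, c x ∂γ := by
  obtain ⟨hγp, hγm⟩ := hγ
  have Fm : ∀ i, Measurable (cdf (ρ i)) := fun i => (monotone_cdf (ρ i)).measurable
  have key := comonotone_le c hsub hcont B hB f hf γ (fun i x => cdf (ρ i) (x i))
    (fun i => (Fm i).comp (measurable_pi_apply i)) (by
      intro i
      have : (fun x : Fin l → ℝ => cdf (ρ i) (x i)) = (cdf (ρ i)) ∘ (fun x => x i) := rfl
      rw [this, ← Measure.map_map (Fm i) (measurable_pi_apply i), hγm i]
      conv_lhs => rw [← hpush i]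
      rw [Measure.map_map, hpush i]
      · conv_rhs => rw [← Measure.map_id (μ := lam)]
        apply Measure.map_congr
        filter_upwards [ae_restrict_mem measurableSet_Ioc] with u hu
        exact cdf_comp_monotone (ρ i) (hac i) (f i) (hf i) (hpush i) u hu
      · rw [hpush i]; exact Fm i
      · exact (hf i).measurable)
  refine key.trans (le_of_eq ?_)
  apply integral_congr_ae
  have : ∀ i, ∀ᵐ x ∂γ, f i (cdf (ρ i) (x i)) = x i := by
    intro i
    have h : ∀ᵐ y ∂(ρ i), f i (cdf (ρ i) y) = y := by
      have hms : MeasurableSet {y | f i (cdf (ρ i) y) = y} :=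
        measurableSet_eq_fun ((hf i).measurable.comp (Fm i)) measurable_id
      have : ∀ᵐ y ∂(lam.map (f i)), f i (cdf (ρ i) y) = y := by
        rw [ae_map_iff (hf i).measurable.aemeasurable hms]
        filter_upwards [ae_restrict_mem measurableSet_Ioc] with u hu
        rw [cdf_comp_monotone (ρ i) (hac i) (f i) (hf i) (hpush i) u hu]
      rwa [hpush i] at this
    rw [← hγm i] at h
    have := ae_of_ae_map (measurable_pi_apply i).aemeasurable h
    rw [hγm i] at this
    exact this
  filter_upwards [ae_all_iff.2 this] with x hx
  simp only [hx]

lemma exists_quantile (a b : ℝ) (hab : a ≤ b) (ρ : Measure ℝ) [IsProbabilityMeasure ρ]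
    (hs : ρ (Icc a b)ᶜ = 0) :
    ∃ q : ℝ → ℝ, Monotone q ∧ (∀ u, q u ∈ Icc a b) ∧ lam.map q = ρ := by
  let F := cdf ρ
  let S : ℝ → Set ℝ := fun u => {x | x ∈ Icc a b ∧ u ≤ F x} ∪ {b}
  have hbS : ∀ u, b ∈ S u := fun u => Or.inr rfl
  have hSI : ∀ u, ∀ x ∈ S u, x ∈ Icc a b := by
    rintro u x (h | h)
    · exact h.1
    · rw [mem_singleton_iff.1 h]; exact ⟨hab, le_rfl⟩
  have hbdd : ∀ u, BddBelow (S u) := fun u => ⟨a, fun x hx => (hSI u x hx).1⟩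
  have Fb : F b = 1 := by
    have : ρ (Iic b) = 1 := by
      rw [← prob_compl_eq_zero_iff measurableSet_Iic]
      refine measure_mono_null ?_ hs
      intro x hx; simp only [mem_compl_iff, mem_Iic, mem_Icc] at *; tauto
    simp only [F]; rw [cdf_eq_real, Measure.real, this]; simp
  have Fa : ∀ x, x < a → F x = 0 := by
    intro x hx
    have : ρ (Iic x) = 0 := by
      refine measure_mono_null ?_ hs
      intro y hy h
      exact absurd (h.1.trans hy) (not_le.2 hx)
    simp only [F]; rw [cdf_eq_real, Measure.real, this]; simp
  have hmono : Monotone (fun u => sInf (S u)) := by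
    intro u v huv
    apply csInf_le_csInf (hbdd u) ⟨b, hbS v⟩
    rintro x (h | h)
    · exact Or.inl ⟨h.1, huv.trans h.2⟩
    · exact Or.inr h
  refine ⟨fun u => sInf (S u), hmono, ?_, ?_⟩
  · intro u
    exact ⟨le_csInf ⟨b, hbS u⟩ fun x hx => (hSI u x hx).1, csInf_le (hbdd u) (hbS u)⟩
  · have hiff : ∀ u ∈ Ioc (0:ℝ) 1, ∀ x, sInf (S u) ≤ x ↔ u ≤ F x := by
      intro u hu x
      constructor
      · intro h
        refine le_trans ?_ (monotone_cdf ρ h)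
        have hr : Tendsto F (𝓝[>] (sInf (S u))) (𝓝 (F (sInf (S u)))) :=
          ((F.right_continuous (sInf (S u))).mono Ioi_subset_Ici_self).tendsto
        refine ge_of_tendsto hr ?_
        filter_upwards [self_mem_nhdsWithin] with y hy
        obtain ⟨s, hsS, hsy⟩ := exists_lt_of_csInf_lt ⟨b, hbS u⟩ hy
        refine le_trans ?_ (monotone_cdf ρ hsy.le)
        rcases hsS with h | h
        · exact h.2
        · rw [mem_singleton_iff.1 h]; exact hu.2.trans Fb.ge
      · intro h
        have hax : a ≤ x := by
          by_contra hc
          rw [Fa x (not_le.1 hc)] at h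
          exact absurd hu.1 (not_lt.2 h)
        rcases le_total x b with hb | hb
        · exact csInf_le (hbdd u) (Or.inl ⟨⟨hax, hb⟩, h⟩)
        · exact (csInf_le (hbdd u) (hbS u)).trans hb
    have : IsProbabilityMeasure (lam.map (fun u => sInf (S u))) :=
      Measure.isProbabilityMeasure_map hmono.measurable.aemeasurable
    apply Measure.ext_of_Iic
    intro x
    rw [Measure.map_apply hmono.measurable measurableSet_Iic]
    have : lam ((fun u => sInf (S u)) ⁻¹' Iic x) = lam (Iic (F x)) := by
      apply measure_congr
      filter_upwards [ae_restrict_mem measurableSet_Ioc] with u hu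
      exact propext (hiff u hu x)
    rw [this, lam_Iic _ (cdf_nonneg ρ x) (cdf_le_one ρ x)]
    change ENNReal.ofReal (cdf ρ x) = _
    rw [cdf_eq_real, ofReal_measureReal]

lemma submodular_of_mixed {l : ℕ} (a b : ℝ) (hab : a < b)
    (K : Set (Fin l → ℝ)) (hK : K = univ.pi fun _ : Fin l => Icc a b)
    (c : (Fin l → ℝ) → ℝ) (hc : ContDiffOn ℝ 2 c K)
    (hmix : ∀ x ∈ K, ∀ i j : Fin l, i ≠ j →
      fderivWithin ℝ (fun y => fderivWithin ℝ c K y (Pi.single i 1)) K x (Pi.single j 1) ≤ 0)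
    (x y : Fin l → ℝ) (hx : x ∈ K) (hy : y ∈ K) :
    c (x ⊔ y) + c (x ⊓ y) ≤ c x + c y := by
  have hud : UniqueDiffOn ℝ K := by
    rw [hK]; exact UniqueDiffOn.univ_pi fun i => uniqueDiffOn_Icc hab
  have hD : ContDiffOn ℝ 1 (fderivWithin ℝ c K) K := hc.fderivWithin hud (by norm_num)
  have hcd : DifferentiableOn ℝ c K := hc.differentiableOn (by norm_num)
  have hDd : DifferentiableOn ℝ (fderivWithin ℝ c K) K := hD.differentiableOn (by norm_num)
  set m := x ⊓ y with hm
  set d := x - m with hd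
  set e := y - m with he
  have hd0 : ∀ i, 0 ≤ d i := fun i => by simp [hd, hm]
  have he0 : ∀ i, 0 ≤ e i := fun i => by simp [he, hm]
  have hde : ∀ i, d i * e i = 0 := by
    intro i
    rcases le_total (x i) (y i) with h | h
    · simp [hd, hm, h]
    · simp [he, hm, h]
  have hsup : x ⊔ y = m + d + e := by
    ext i
    rcases le_total (x i) (y i) with h | h
    · simp [hd, he, hm, h]
    · simp [hd, he, hm, h]
  have hmem : ∀ s ∈ Icc (0:ℝ) 1, ∀ r ∈ Icc (0:ℝ) 1, m + s • d + r • e ∈ K := by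
    intro s hs r hr
    rw [hK] at hx hy ⊢
    intro i _
    have hxi := hx i trivial
    have hyi := hy i trivial
    have := hd0 i
    have := he0 i
    simp only [mem_Icc] at hs hr hxi hyi
    rcases le_total (x i) (y i) with h | h
    · have e1 : d i = 0 := by simp [hd, hm, h]
      have e2 : e i = y i - x i := by simp [he, hm, h]
      have e3 : m i = x i := by simp [hm, h]
      simp only [Pi.add_apply, Pi.smul_apply, smul_eq_mul, e1, e2, e3, mem_Icc]
      constructor <;> nlinarith
    · have e1 : e i = 0 := by simp [he, hm, h]
      have e2 : d i = x i - y i := by simp [hd, hm, h]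
      have e3 : m i = y i := by simp [hm, h]
      simp only [Pi.add_apply, Pi.smul_apply, smul_eq_mul, e1, e2, e3, mem_Icc]
      constructor <;> nlinarith
  -- second derivative in directions d, e
  have hsecond : ∀ z ∈ K, (fderivWithin ℝ (fderivWithin ℝ c K) K z e) d ≤ 0 := by
    intro z hz
    set H := fderivWithin ℝ (fderivWithin ℝ c K) K z with hH
    have hij : ∀ i j, i ≠ j → (H (Pi.single j 1)) (Pi.single i 1) ≤ 0 := by
      intro i j hne
      have h1 := hmix z hz i j hne
      have h2 : HasFDerivWithinAt (fun y => fderivWithin ℝ c K y (Pi.single i 1))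
          ((ContinuousLinearMap.apply ℝ ℝ (Pi.single i 1 : Fin l → ℝ)).comp H) K z :=
        (ContinuousLinearMap.apply ℝ ℝ (Pi.single i 1 : Fin l → ℝ)).hasFDerivAt.comp_hasFDerivWithinAt
          z (hDd z hz).hasFDerivWithinAt
      rw [h2.fderivWithin (hud z hz)] at h1
      simpa using h1
    have hexp : ∀ v : Fin l → ℝ, v = ∑ i, v i • (Pi.single i 1 : Fin l → ℝ) := by
      intro v
      ext j
      simp [Finset.sum_apply, Pi.single_apply]
    rw [hexp e, hexp d]
    simp only [map_sum, map_smul, ContinuousLinearMap.sum_apply, ContinuousLinearMap.smul_apply,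
      smul_eq_mul]
    refine Finset.sum_nonpos fun i _ => ?_
    rw [← smul_eq_mul, Finset.smul_sum]
    refine Finset.sum_nonpos fun j _ => ?_
    by_cases h : i = j
    · subst h
      have := hde i
      simp only [smul_eq_mul]
      rw [← mul_assoc, this, zero_mul]
    · have h3 := hij i j h
      have h4 := mul_nonneg (hd0 i) (he0 j)
      simp only [smul_eq_mul]
      rw [← mul_assoc]
      exact mul_nonpos_of_nonneg_of_nonpos h4 h3
  have h01 : (0:ℝ) ∈ Icc (0:ℝ) 1 := by simp
  have h11 : (1:ℝ) ∈ Icc (0:ℝ) 1 := by simp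
  -- first derivative in direction d decreases along e
  have hfirst : ∀ s ∈ Icc (0:ℝ) 1,
      fderivWithin ℝ c K (m + s • d + (1:ℝ) • e) d ≤ fderivWithin ℝ c K (m + s • d + (0:ℝ) • e) d := by
    intro s hs
    have hder : ∀ r ∈ Icc (0:ℝ) 1, HasDerivWithinAt
        (fun r : ℝ => fderivWithin ℝ c K (m + s • d + r • e) d)
        ((fderivWithin ℝ (fderivWithin ℝ c K) K (m + s • d + r • e) e) d) (Icc 0 1) r := by
      intro r hr
      have hp : HasDerivWithinAt (fun r : ℝ => m + s • d + r • e) e (Icc 0 1) r := by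
        simpa using (((hasDerivAt_id r).smul_const e).const_add (m + s • d)).hasDerivWithinAt
      have h1 := (hDd _ (hmem s hs r hr)).hasFDerivWithinAt.comp_hasDerivWithinAt r hp
        (fun r hr => hmem s hs r hr)
      exact ((ContinuousLinearMap.apply ℝ ℝ d).hasFDerivAt.comp_hasDerivWithinAt r h1)
    have hanti : AntitoneOn (fun r : ℝ => fderivWithin ℝ c K (m + s • d + r • e) d) (Icc 0 1) := by
      refine antitoneOn_of_hasDerivWithinAt_nonpos (convex_Icc 0 1)
        (f' := fun r => (fderivWithin ℝ (fderivWithin ℝ c K) K (m + s • d + r • e) e) d)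
        (fun r hr => (hder r hr).continuousWithinAt)
        (fun r hr => (hder r (interior_subset hr)).mono interior_subset)
        (fun r hr => hsecond _ (hmem s hs r (interior_subset hr)))
    exact hanti h01 h11 zero_le_one
  have hder : ∀ r ∈ Icc (0:ℝ) 1, ∀ s ∈ Icc (0:ℝ) 1, HasDerivWithinAt
      (fun s : ℝ => c (m + s • d + r • e))
      (fderivWithin ℝ c K (m + s • d + r • e) d) (Icc 0 1) s := by
    intro r hr s hs
    have hp : HasDerivWithinAt (fun s : ℝ => m + s • d + r • e) d (Icc 0 1) s := by
      simpa using ((((hasDerivAt_id s).smul_const d).const_add m).add_const (r • e)).hasDerivWithinAt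
    exact (hcd _ (hmem s hs r hr)).hasFDerivWithinAt.comp_hasDerivWithinAt s hp
      (fun s hs => hmem s hs r hr)
  have hanti : AntitoneOn (fun s : ℝ => c (m + s • d + (1:ℝ) • e) - c (m + s • d + (0:ℝ) • e))
      (Icc 0 1) := by
    refine antitoneOn_of_hasDerivWithinAt_nonpos (convex_Icc 0 1)
      (f' := fun s => fderivWithin ℝ c K (m + s • d + (1:ℝ) • e) d
        - fderivWithin ℝ c K (m + s • d + (0:ℝ) • e) d)
      (fun s hs => ((hder 1 h11 s hs).sub (hder 0 h01 s hs)).continuousWithinAt)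
      (fun s hs => ((hder 1 h11 s (interior_subset hs)).sub
        (hder 0 h01 s (interior_subset hs))).mono interior_subset)
      (fun s hs => sub_nonpos.2 (hfirst s (interior_subset hs)))
  have h := hanti h01 h11 zero_le_one
  simp only [one_smul, zero_smul, add_zero] at h
  have ex : m + d = x := by simp [hd]
  have ey : m + e = y := by simp [he]
  rw [hsup]
  rw [ex, ey] at h
  rw [ex]
  linarith

/-- Clamping to the interval. -/
def clamp (a b x : ℝ) : ℝ := max a (min b x)

lemma clamp_mono (a b : ℝ) : Monotone (clamp a b) := fun _ _ h =>
  max_le_max le_rfl (min_le_min le_rfl h)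

lemma clamp_mem {a b : ℝ} (hab : a ≤ b) (x : ℝ) : clamp a b x ∈ Icc a b :=
  ⟨le_max_left _ _, max_le hab (min_le_left _ _)⟩

lemma clamp_of_mem {a b x : ℝ} (hx : x ∈ Icc a b) : clamp a b x = x := by
  simp [clamp, hx.1, hx.2]

lemma clamp_continuous (a b : ℝ) : Continuous (clamp a b) := by
  unfold clamp; fun_prop

theorem stmt3 {l : ℕ} (hl : 1 ≤ l) (a b : ℝ) (hab : a ≤ b)
    (K : Set (Fin l → ℝ)) (hK : K = univ.pi fun _ : Fin l => Icc a b)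
    (c : (Fin l → ℝ) → ℝ)
    (hc : ContDiffOn ℝ 2 c K) (hconv : ConvexOn ℝ K c)
    (hmix : ∀ x ∈ K, ∀ i j : Fin l, i ≠ j →
      fderivWithin ℝ (fun y => fderivWithin ℝ c K y (Pi.single i 1)) K x (Pi.single j 1) ≤ 0)
    (ρ0 ρ1 : Fin l → Measure ℝ)
    (h0 : ∀ i, IsProbabilityMeasure (ρ0 i) ∧ ρ0 i ≪ volume ∧ ρ0 i (Icc a b)ᶜ = 0)
    (h1 : ∀ i, IsProbabilityMeasure (ρ1 i) ∧ ρ1 i ≪ volume ∧ ρ1 i (Icc a b)ᶜ = 0)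
    (T : Fin l → ℝ → ℝ)
    (hTmeas : ∀ i, Measurable (T i))
    (hTmono : ∀ i, MonotoneOn (T i) (Icc a b))
    (hTpush : ∀ i, (ρ0 i).map (T i) = ρ1 i)
    (hTopt : ∀ i, ∫ x, ‖x - T i x‖ ^ 2 ∂(ρ0 i) = W2 (ρ0 i) (ρ1 i) ^ 2)
    (t : ℝ) (ht : t ∈ Icc (0:ℝ) 1) :
    Wc c (fun i => (ρ0 i).map (fun x => (1 - t) * x + t * T i x)) ≤
      (1 - t) * Wc c ρ0 + t * Wc c ρ1 := by
  have hab' : a < b := by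
    rcases hab.lt_or_eq with h | h
    · exact h
    · exfalso
      obtain ⟨hp, hac, hs⟩ := h0 ⟨0, hl⟩
      have h2 : ρ0 ⟨0, hl⟩ (Icc a b) = 0 := hac (by simp [h])
      have : ρ0 ⟨0, hl⟩ univ ≤ 0 := by
        rw [← union_compl_self (Icc a b)]
        exact (measure_union_le _ _).trans (by rw [h2, hs]; simp)
      simp at this
  have hp0 : ∀ i, IsProbabilityMeasure (ρ0 i) := fun i => (h0 i).1
  have hp1 : ∀ i, IsProbabilityMeasure (ρ1 i) := fun i => (h1 i).1
  -- the globally defined cost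
  let C : (Fin l → ℝ) → ℝ := fun x => c (fun i => clamp a b (x i))
  have hcl : ∀ x : Fin l → ℝ, (fun i => clamp a b (x i)) ∈ K := by
    intro x; rw [hK]; exact fun i _ => clamp_mem hab _
  have hCK : ∀ x ∈ K, C x = c x := by
    intro x hx
    rw [hK] at hx
    have : (fun i => clamp a b (x i)) = x := by
      ext i; exact clamp_of_mem (hx i trivial)
    simp only [C, this]
  have hCcont : Continuous C :=
    hc.continuousOn.comp_continuous
      (continuous_pi fun i => (clamp_continuous a b).comp (continuous_apply i)) hcl
  have hKc : IsCompact K := by rw [hK]; exact isCompact_univ_pi fun _ => isCompact_Icc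
  obtain ⟨B, hB⟩ := hKc.exists_bound_of_continuousOn hc.continuousOn
  have hCB : ∀ x, |C x| ≤ B := fun x => hB _ (hcl x)
  have hCsub : ∀ x y, C (x ⊔ y) + C (x ⊓ y) ≤ C x + C y := by
    intro x y
    have := submodular_of_mixed a b hab' K hK c hc hmix _ _ (hcl x) (hcl y)
    have e1 : (fun i => clamp a b ((x ⊔ y) i))
        = (fun i => clamp a b (x i)) ⊔ (fun i => clamp a b (y i)) := by
      ext i; exact (clamp_mono a b).map_sup _ _
    have e2 : (fun i => clamp a b ((x ⊓ y) i))
        = (fun i => clamp a b (x i)) ⊓ (fun i => clamp a b (y i)) := by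
      ext i; exact (clamp_mono a b).map_inf _ _
    simp only [C]
    rw [e1, e2]
    exact this
  have hplanC : ∀ ρ : Fin l → Measure ℝ, (∀ i, ρ i (Icc a b)ᶜ = 0) → ∀ γ ∈ Plans ρ,
      ∫ x, c x ∂γ = ∫ x, C x ∂γ := by
    intro ρ hρ γ hγ
    apply integral_congr_ae
    have : ∀ i, ∀ᵐ x ∂γ, x i ∈ Icc a b := by
      intro i
      have h : ∀ᵐ y ∂(ρ i), y ∈ Icc a b := hρ i
      rw [← hγ.2 i] at h
      exact ae_of_ae_map (measurable_pi_apply i).aemeasurable h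
    filter_upwards [ae_all_iff.2 this] with x hx
    exact (hCK x (by rw [hK]; exact fun i _ => hx i)).symm
  have hplanmap : ∀ (ρ : Fin l → Measure ℝ) (f : Fin l → ℝ → ℝ), (∀ i, Measurable (f i)) →
      (∀ i, lam.map (f i) = ρ i) → lam.map (fun u i => f i u) ∈ Plans ρ := by
    intro ρ f hf hpush
    have hm : Measurable (fun u i => f i u) := measurable_pi_lambda _ hf
    refine ⟨Measure.isProbabilityMeasure_map hm.aemeasurable, fun i => ?_⟩
    rw [Measure.map_map (measurable_pi_apply i) hm, ← hpush i]
    rfl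
  have hopt : ∀ (ρ : Fin l → Measure ℝ) (f : Fin l → ℝ → ℝ), (∀ i, Monotone (f i)) →
      (∀ i, IsProbabilityMeasure (ρ i) ∧ ρ i ≪ volume ∧ ρ i (Icc a b)ᶜ = 0) →
      (∀ i, lam.map (f i) = ρ i) → ∫ u, C (fun i => f i u) ∂lam ≤ Wc c ρ := by
    intro ρ f hf hρ hpush
    refine le_csInf ⟨_, _, hplanmap ρ f (fun i => (hf i).measurable) hpush, rfl⟩ ?_
    rintro _ ⟨γ, hγ, rfl⟩
    simp only
    rw [hplanC ρ (fun i => (hρ i).2.2) γ hγ]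
    exact comonotone_opt C hCsub hCcont B hCB f hf ρ (fun i => (hρ i).1) (fun i => (hρ i).2.1)
      hpush γ hγ
  -- quantiles
  choose q hqm hqI hqpush using fun i => exists_quantile a b hab (ρ0 i) (h0 i).2.2
  let S : Fin l → ℝ → ℝ := fun i x => clamp a b (T i (clamp a b x))
  have hSm : ∀ i, Monotone (S i) := fun i x y h =>
    clamp_mono a b (hTmono i (clamp_mem hab _) (clamp_mem hab _) (clamp_mono a b h))
  have hST : ∀ i, ∀ᵐ x ∂(ρ0 i), S i x = T i x := by
    intro i
    have ha : ∀ᵐ x ∂(ρ0 i), x ∈ Icc a b := (h0 i).2.2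
    have hb : ∀ᵐ y ∂(ρ1 i), y ∈ Icc a b := (h1 i).2.2
    rw [← hTpush i] at hb
    have hb' := ae_of_ae_map (hTmeas i).aemeasurable hb
    filter_upwards [ha, hb'] with x hx hTx
    simp only [S]
    rw [clamp_of_mem hx, clamp_of_mem hTx]
  have hpush1 : ∀ i, lam.map (fun u => S i (q i u)) = ρ1 i := by
    intro i
    have : (fun u => S i (q i u)) = S i ∘ q i := rfl
    rw [this, ← Measure.map_map (hSm i).measurable (hqm i).measurable, hqpush i, ← hTpush i]
    exact Measure.map_congr (hST i)
  have hpusht : ∀ i, lam.map (fun u => (1 - t) * q i u + t * S i (q i u))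
      = (ρ0 i).map (fun x => (1 - t) * x + t * T i x) := by
    intro i
    have hmS : Measurable (fun x => (1 - t) * x + t * S i x) :=
      (measurable_id.const_mul _).add ((hSm i).measurable.const_mul _)
    have : (fun u => (1 - t) * q i u + t * S i (q i u))
        = (fun x => (1 - t) * x + t * S i x) ∘ q i := rfl
    rw [this, ← Measure.map_map hmS (hqm i).measurable, hqpush i]
    apply Measure.map_congr
    filter_upwards [hST i] with x hx
    rw [hx]
  have hmt : ∀ i, Measurable (fun u => (1 - t) * q i u + t * S i (q i u)) := fun i =>
    ((hqm i).measurable.const_mul _).add (((hSm i).measurable.comp (hqm i).measurable).const_mul _)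
  have hIt : ∀ i u, (1 - t) * q i u + t * S i (q i u) ∈ Icc a b := by
    intro i u
    exact (convex_Icc a b) (hqI i u) (clamp_mem hab _) (by linarith [ht.2]) ht.1 (by ring)
  have hst : ∀ i, ((ρ0 i).map (fun x => (1 - t) * x + t * T i x)) (Icc a b)ᶜ = 0 := by
    intro i
    rw [← hpusht i, Measure.map_apply (hmt i) measurableSet_Icc.compl]
    convert measure_empty (μ := lam)
    ext u
    simp only [mem_preimage, mem_compl_iff, mem_empty_iff_false, iff_false, not_not]
    exact hIt i u
  have hle : Wc c (fun i => (ρ0 i).map (fun x => (1 - t) * x + t * T i x)) ≤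
      ∫ u, C (fun i => (1 - t) * q i u + t * S i (q i u)) ∂lam := by
    have hγ := hplanmap _ _ hmt hpusht
    have e := hplanC _ hst _ hγ
    rw [integral_map (measurable_pi_lambda _ hmt).aemeasurable
      hCcont.measurable.aestronglyMeasurable] at e
    rw [← e]
    refine csInf_le ⟨-B, ?_⟩ ⟨_, hγ, rfl⟩
    rintro _ ⟨γ, hγ, rfl⟩
    simp only
    rw [hplanC _ hst γ hγ]
    have := hγ.1
    have hi : Integrable C γ := cont_bdd_integrable γ C hCcont.measurable B hCB
    calc -B = ∫ _, -B ∂γ := by simp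
      _ ≤ ∫ x, C x ∂γ := integral_mono (integrable_const _) hi fun x => (abs_le.1 (hCB x)).1
  have i0 : Integrable (fun u => C (fun i => q i u)) lam :=
    cont_bdd_integrable _ _ (hCcont.measurable.comp
      (measurable_pi_lambda _ fun i => (hqm i).measurable)) B fun _ => hCB _
  have i1 : Integrable (fun u => C (fun i => S i (q i u))) lam :=
    cont_bdd_integrable _ _ (hCcont.measurable.comp
      (measurable_pi_lambda _ fun i => (hSm i).measurable.comp (hqm i).measurable)) B fun _ => hCB _
  have it : Integrable (fun u => C (fun i => (1 - t) * q i u + t * S i (q i u))) lam :=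
    cont_bdd_integrable _ _ (hCcont.measurable.comp (measurable_pi_lambda _ hmt)) B fun _ => hCB _
  have hcv : ∫ u, C (fun i => (1 - t) * q i u + t * S i (q i u)) ∂lam
      ≤ (1 - t) * ∫ u, C (fun i => q i u) ∂lam + t * ∫ u, C (fun i => S i (q i u)) ∂lam := by
    rw [← integral_const_mul, ← integral_const_mul,
      ← integral_add (i0.const_mul _) (i1.const_mul _)]
    refine integral_mono it ((i0.const_mul _).add (i1.const_mul _)) fun u => ?_
    have m0 : (fun i => q i u) ∈ K := by rw [hK]; exact fun i _ => hqI i u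
    have m1 : (fun i => S i (q i u)) ∈ K := by rw [hK]; exact fun i _ => clamp_mem hab _
    have mt : (fun i => (1 - t) * q i u + t * S i (q i u)) ∈ K := by
      rw [hK]; exact fun i _ => hIt i u
    simp only
    rw [hCK _ m0, hCK _ m1, hCK _ mt]
    exact hconv.2 m0 m1 (by linarith [ht.2]) ht.1 (by ring)
  have hw0 := hopt ρ0 q hqm h0 hqpush
  have hw1 := hopt ρ1 (fun i u => S i (q i u)) (fun i => (hSm i).comp (hqm i)) h1 hpush1
  have ht1 : 0 ≤ 1 - t := by linarith [ht.2]
  have := mul_le_mul_of_nonneg_left hw0 ht1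
  have := mul_le_mul_of_nonneg_left hw1 ht.1
  linarith
end
end

section
/- Approximation of a multi-marginal plan with prescribed nearby marginals: let Ω ⊂ ℝⁿ be compact, let λ̄ ∈ Π(ρ_1,…,ρ_l), and let ρ_{1,h},…,ρ_{l,h} be further probability measures. Then there exists λ̄_h ∈ Π(ρ_{1,h},…,ρ_{l,h}) with W_1(λ̄, λ̄_h) ≤ ∑_{i=1}^l W_2(ρ_i, ρ_{i,h}), where W_1 is the 1-Wasserstein distance on P(Ω^l) for the cost |x_1 − y_1| + ⋯ + |x_l − y_l|. -/
open MeasureTheory Set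

noncomputable section

/-- 1-Wasserstein distance on `P(Ω^l)` for the cost `∑ i, |x_i - y_i|`. -/
noncomputable def W1prod {E : Type*} [MeasurableSpace E] [NormedAddCommGroup E] {l : ℕ}
    (γ γ' : Measure (Fin l → E)) : ℝ :=
  sInf { r : ℝ | ∃ π : Measure ((Fin l → E) × (Fin l → E)), IsProbabilityMeasure π ∧
    π.map Prod.fst = γ ∧ π.map Prod.snd = γ' ∧ r = ∫ p, ∑ i, ‖p.1 i - p.2 i‖ ∂π }


open ProbabilityTheory

lemma coupling_ae_mem {E : Type*} [MeasurableSpace E] {Ω : Set E} (hΩ : MeasurableSet Ω)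
    {μ ν : Measure E} (hμ : μ Ωᶜ = 0) (hν : ν Ωᶜ = 0) {π : Measure (E × E)}
    (h1 : π.map Prod.fst = μ) (h2 : π.map Prod.snd = ν) : π (Ω ×ˢ Ω)ᶜ = 0 := by
  have e1 : π (Prod.fst ⁻¹' Ωᶜ) = 0 := by
    rw [← Measure.map_apply measurable_fst hΩ.compl, h1, hμ]
  have e2 : π (Prod.snd ⁻¹' Ωᶜ) = 0 := by
    rw [← Measure.map_apply measurable_snd hΩ.compl, h2, hν]
  refine measure_mono_null ?_ (measure_union_null e1 e2)
  intro p hp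
  by_contra hc
  simp only [mem_union, mem_preimage, mem_compl_iff, not_or, not_not] at hc
  exact hp ⟨hc.1, hc.2⟩

lemma exists_opt {E : Type*} [NormedAddCommGroup E] [MeasurableSpace E]
    [BorelSpace E] [SecondCountableTopology E] {Ω : Set E} (hΩ : IsCompact Ω)
    (μ ν : Measure E) [IsProbabilityMeasure μ] [IsProbabilityMeasure ν]
    (hμ : μ Ωᶜ = 0) (hν : ν Ωᶜ = 0) :
    ∃ π : Measure (E × E),
      IsProbabilityMeasure π ∧ π.map Prod.fst = μ ∧ π.map Prod.snd = ν ∧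
      W2 μ ν = Real.sqrt (∫ p, ‖p.1 - p.2‖ ^ 2 ∂π) := by
  let S : Set (ProbabilityMeasure (E × E)) :=
    {π | (π : Measure (E × E)).map Prod.fst = μ ∧ (π : Measure (E × E)).map Prod.snd = ν}
  have hnull : ∀ π ∈ S, (π : Measure (E × E)) (Ω ×ˢ Ω)ᶜ = 0 := fun π hπ =>
    coupling_ae_mem hΩ.measurableSet hμ hν hπ.1 hπ.2
  have hne : S.Nonempty := by
    refine ⟨⟨μ.prod ν, inferInstance⟩, ?_, ?_⟩ <;> simp
  have hcl : IsClosed S := by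
    have c1 : Continuous fun π : ProbabilityMeasure (E × E) =>
        π.map (continuous_fst (X := E) (Y := E)).measurable.aemeasurable :=
      ProbabilityMeasure.continuous_map continuous_fst
    have c2 : Continuous fun π : ProbabilityMeasure (E × E) =>
        π.map (continuous_snd (X := E) (Y := E)).measurable.aemeasurable :=
      ProbabilityMeasure.continuous_map continuous_snd
    have : S = (fun π : ProbabilityMeasure (E × E) =>
        π.map (continuous_fst (X := E) (Y := E)).measurable.aemeasurable) ⁻¹' {⟨μ, inferInstance⟩}
        ∩ (fun π : ProbabilityMeasure (E × E) =>
        π.map (continuous_snd (X := E) (Y := E)).measurable.aemeasurable) ⁻¹'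
          {⟨ν, inferInstance⟩} := by
      ext π
      constructor
      · rintro ⟨ha, hb⟩
        exact ⟨Subtype.ext ha, Subtype.ext hb⟩
      · rintro ⟨ha, hb⟩
        exact ⟨congrArg Subtype.val ha, congrArg Subtype.val hb⟩
    rw [this]
    exact (isClosed_singleton.preimage c1).inter (isClosed_singleton.preimage c2)
  have hcomp : IsCompact S := by
    rw [← hcl.closure_eq]
    apply isCompact_closure_of_isTightMeasureSet
    rw [isTightMeasureSet_iff_exists_isCompact_measure_compl_le]
    intro ε _
    refine ⟨Ω ×ˢ Ω, hΩ.prod hΩ, ?_⟩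
    rintro _ ⟨π, hπ, rfl⟩
    rw [hnull π hπ]
    exact zero_le
  obtain ⟨C, hC⟩ : ∃ C : ℝ, ∀ p ∈ Ω ×ˢ Ω, ‖p.1 - p.2‖ ^ 2 ≤ C := by
    obtain ⟨C, hC⟩ := (hΩ.prod hΩ).bddAbove_image
      (f := fun p : E × E => ‖p.1 - p.2‖ ^ 2) (by fun_prop)
    exact ⟨C, fun p hp => hC ⟨p, hp, rfl⟩⟩
  let f : BoundedContinuousFunction (E × E) ℝ :=
    BoundedContinuousFunction.ofNormedAddCommGroup
      (fun p => min (‖p.1 - p.2‖ ^ 2) |C|) (by fun_prop) |C| (by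
        intro p
        rw [Real.norm_of_nonneg (by positivity)]
        exact min_le_right _ _)
  have hf : ∀ π ∈ S, ∫ p, f p ∂(π : Measure (E × E)) =
      ∫ p, ‖p.1 - p.2‖ ^ 2 ∂(π : Measure (E × E)) := by
    intro π hπ
    apply integral_congr_ae
    have : ∀ᵐ p ∂(π : Measure (E × E)), p ∈ Ω ×ˢ Ω := hnull π hπ
    filter_upwards [this] with p hp
    exact min_eq_left ((hC p hp).trans (le_abs_self C))
  obtain ⟨π, hπ, hmin⟩ := hcomp.exists_isMinOn hne
    (ProbabilityMeasure.continuous_integral_boundedContinuousFunction f).continuousOn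
  refine ⟨π, inferInstance, hπ.1, hπ.2, ?_⟩
  unfold W2
  congr 1
  apply IsLeast.csInf_eq
  refine ⟨⟨π, inferInstance, hπ.1, hπ.2, rfl⟩, ?_⟩
  rintro _ ⟨π', h', h1, h2, rfl⟩
  have hπ' : (⟨π', h'⟩ : ProbabilityMeasure (E × E)) ∈ S := ⟨h1, h2⟩
  have := isMinOn_iff.1 hmin _ hπ'
  exact (hf _ hπ).symm.le.trans (this.trans (hf _ hπ').le)

lemma integral_le_sqrt {α : Type*} [MeasurableSpace α] (π : Measure α) [IsProbabilityMeasure π]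
    (f : α → ℝ) (hf : MemLp f 2 π) : ∫ x, f x ∂π ≤ Real.sqrt (∫ x, f x ^ 2 ∂π) := by
  apply Real.le_sqrt_of_sq_le
  have h := variance_nonneg f π
  rw [variance_eq_sub hf] at h
  simpa using h

lemma exists_glue {E : Type*} [MeasurableSpace E] [StandardBorelSpace E] [Nonempty E] {l : ℕ}
    (ρ : Fin l → Measure E) (γ : Fin l → Measure (E × E)) (hγ : ∀ i, IsProbabilityMeasure (γ i))
    (hγ1 : ∀ i, (γ i).map Prod.fst = ρ i) (γbar : Measure (Fin l → E))
    (hγbar : γbar ∈ Plans ρ) :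
    ∃ π : Measure ((Fin l → E) × (Fin l → E)), IsProbabilityMeasure π ∧
      π.map Prod.fst = γbar ∧ ∀ i, π.map (fun p => (p.1 i, p.2 i)) = γ i := by
  obtain ⟨hP, hm⟩ := hγbar
  let K : Kernel (Fin l → E) (Fin l → E) :=
    { toFun := fun x => Measure.pi fun i => (γ i).condKernel (x i)
      measurable' := by
        refine Measurable.measure_of_isPiSystem_of_isProbabilityMeasure
          generateFrom_pi.symm isPiSystem_pi ?_
        rintro _ ⟨s, hs, rfl⟩
        simp only [Measure.pi_pi]
        refine Finset.measurable_prod _ fun i _ => ?_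
        exact (Kernel.measurable_coe _ (hs i (mem_univ i))).comp (measurable_pi_apply i) }
  have hK : ∀ x, K x = Measure.pi fun i => (γ i).condKernel (x i) := fun x => rfl
  have : IsMarkovKernel K := ⟨fun x => by rw [hK]; infer_instance⟩
  refine ⟨γbar ⊗ₘ K, inferInstance, Measure.fst_compProd _ _, fun i => ?_⟩
  have hmeas : Measurable fun p : (Fin l → E) × (Fin l → E) => (p.1 i, p.2 i) := by fun_prop
  conv_rhs => rw [← (γ i).disintegrate (γ i).condKernel]
  ext s hs
  rw [Measure.map_apply hmeas hs, Measure.compProd_apply (hmeas hs), Measure.compProd_apply hs,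
    Measure.fst, hγ1, ← hm i, lintegral_map (Kernel.measurable_kernel_prodMk_left hs)
      (measurable_pi_apply i)]
  refine lintegral_congr fun x => ?_
  rw [hK]
  have := (measurePreserving_eval (fun i => (γ i).condKernel (x i)) i).measure_preimage
    (measurable_prodMk_left (x := x i) hs).nullMeasurableSet
  rw [← this]
  rfl

theorem stmt11 {n l : ℕ} (hl : 1 ≤ l) (Ω : Set (EuclideanSpace ℝ (Fin n)))
    (hΩ : IsCompact Ω)
    (ρ ρh : Fin l → Measure (EuclideanSpace ℝ (Fin n)))
    (hρ : ∀ i, IsProbabilityMeasure (ρ i)) (hρΩ : ∀ i, ρ i Ωᶜ = 0)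
    (hρh : ∀ i, IsProbabilityMeasure (ρh i)) (hρhΩ : ∀ i, ρh i Ωᶜ = 0)
    (γbar : Measure (Fin l → EuclideanSpace ℝ (Fin n))) (hγbar : γbar ∈ Plans ρ) :
    ∃ γbarh ∈ Plans ρh, W1prod γbar γbarh ≤ ∑ i, W2 (ρ i) (ρh i) := by
  choose γ hγ h1 h2 hW using fun i =>
    have := hρ i
    have := hρh i
    exists_opt hΩ (ρ i) (ρh i) (hρΩ i) (hρhΩ i)
  obtain ⟨π, hπ, hfst, hpair⟩ := exists_glue ρ γ hγ h1 γbar hγbar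
  have hmeas : ∀ i, Measurable fun p : (Fin l → EuclideanSpace ℝ (Fin n)) ×
      (Fin l → EuclideanSpace ℝ (Fin n)) => (p.1 i, p.2 i) := fun i => by fun_prop
  have hLp : ∀ i, MemLp (fun p : EuclideanSpace ℝ (Fin n) × EuclideanSpace ℝ (Fin n) =>
      ‖p.1 - p.2‖) 2 (γ i) := by
    intro i
    have := hγ i
    obtain ⟨C, hC⟩ := (hΩ.prod hΩ).bddAbove_image
      (f := fun p : EuclideanSpace ℝ (Fin n) × EuclideanSpace ℝ (Fin n) => ‖p.1 - p.2‖)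
      (by fun_prop)
    refine MemLp.of_bound (by fun_prop) C ?_
    have : ∀ᵐ p ∂(γ i), p ∈ Ω ×ˢ Ω :=
      coupling_ae_mem hΩ.measurableSet (hρΩ i) (hρhΩ i) (h1 i) (h2 i)
    filter_upwards [this] with p hp
    rw [norm_norm]
    exact hC ⟨p, hp, rfl⟩
  have hint : ∀ i, Integrable (fun p : (Fin l → EuclideanSpace ℝ (Fin n)) ×
      (Fin l → EuclideanSpace ℝ (Fin n)) => ‖p.1 i - p.2 i‖) π := by
    intro i
    have := hγ i
    have h := (hLp i).integrable (by norm_num)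
    rw [← hpair i] at h
    exact h.comp_measurable (hmeas i)
  refine ⟨π.map Prod.snd, ⟨Measure.isProbabilityMeasure_map measurable_snd.aemeasurable,
    fun i => ?_⟩, ?_⟩
  · rw [← h2 i, ← hpair i, Measure.map_map (by fun_prop) (by fun_prop),
      Measure.map_map (by fun_prop) (by fun_prop)]
    rfl
  · have hle : W1prod γbar (π.map Prod.snd) ≤ ∫ p, ∑ i, ‖p.1 i - p.2 i‖ ∂π := by
      refine csInf_le ⟨0, ?_⟩ ⟨π, hπ, hfst, rfl, rfl⟩
      rintro _ ⟨π', -, -, -, rfl⟩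
      positivity
    refine hle.trans ?_
    rw [integral_finsetSum _ fun i _ => hint i]
    refine Finset.sum_le_sum fun i _ => ?_
    have := hγ i
    have e : ∫ p, ‖p.1 i - p.2 i‖ ∂π = ∫ p, ‖p.1 - p.2‖ ∂(γ i) := by
      rw [← hpair i, integral_map (hmeas i).aemeasurable (by fun_prop)]
    rw [e, hW i]
    exact integral_le_sqrt (γ i) _ (hLp i)
end
end
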